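/- arXiv:1509.00394 — 2 statements merged into one kernel-verified Lean document; each statement's English description precedes it below -/
import Mathlib

section
/- For any bounded measurable function φ on X and any p ∈ {0, …, n}: μ_{e_p}(φ⊗φ) = γ_p(1) · γ_p(Q_{p,n}(φ)²), and consequently v_{p,n}(φ) = η_p(Q_{p,n}(φ)²) / η_p(Q_{p,n}(1))² − η_n(φ)². -/
open MeasureTheory ProbabilityTheory Filter
open scoped ENNReal NNReal Classical

noncomputable section

namespace PFVar

variable {X : Type*} [MeasurableSpace X]

/-- The unnormalized Feynman–Kac measures `γ_p`. -/
def gammaFK (M0 : Measure X) (M : ℕ → Kernel X X) (G : ℕ → X → ℝ) : ℕ → Measure X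
  | 0 => M0
  | p + 1 =>
      ((gammaFK M0 M G p).withDensity fun x => ENNReal.ofReal (G p x)).bind
        (fun x => M (p + 1) x)

/-- `γ_n(φ)`. -/
def gInt (M0 : Measure X) (M : ℕ → Kernel X X) (G : ℕ → X → ℝ) (n : ℕ) (φ : X → ℝ) : ℝ :=
  ∫ x, φ x ∂(gammaFK M0 M G n)

/-- `η_n(φ) = γ_n(φ)/γ_n(1)`. -/
def eInt (M0 : Measure X) (M : ℕ → Kernel X X) (G : ℕ → X → ℝ) (n : ℕ) (φ : X → ℝ) : ℝ :=
  gInt M0 M G n φ / gInt M0 M G n 1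

/-- Law of the path `(X_0,…,X_k)` of an inhomogeneous Markov chain with initial law `μ0` and
transitions `κ`, recorded as an element of `ℕ → Y` (coordinates beyond `k` are junk). -/
def markovPath {Y : Type*} [MeasurableSpace Y] (μ0 : Measure Y) (κ : ℕ → Y → Measure Y) :
    ℕ → Measure (ℕ → Y)
  | 0 => μ0.map fun y _ => y
  | k + 1 =>
      (markovPath μ0 κ k).bind fun ω =>
        (κ (k + 1) (ω k)).map fun y => Function.update ω (k + 1) y

/-- Categorical distribution on `{0,…,m−1} ⊆ ℕ` with weights `w`. -/
def cat (m : ℕ) (w : ℕ → ℝ) : Measure ℕ :=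
  (∑ j ∈ Finset.range m, ENNReal.ofReal (w j))⁻¹ •
    ∑ j ∈ Finset.range m, ENNReal.ofReal (w j) • Measure.dirac j

/-- Uniform distribution on `{0,…,m−1}`. -/
def unif (m : ℕ) : Measure ℕ := cat m fun _ => 1

/-- Extend a finite tuple to `ℕ` with junk values. -/
def padF {Y : Type*} [Nonempty Y] {m : ℕ} (f : Fin m → Y) : ℕ → Y := fun i =>
  if h : i < m then f ⟨i, h⟩ else Classical.arbitrary Y

/-- One resampling/mutation step of the particle filter: given the time-`p` configuration `z`,
the joint law of the ancestor indices `A_p` and the time-`p+1` particle configuration;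
each of the `Np (p+1)` new particles independently draws an ancestor from the categorical
distribution with weights `G p (z j)`, `j < Np p`, and then moves according to `M (p+1)`. -/
def pfStep [Nonempty X] (M : ℕ → Kernel X X) (G : ℕ → X → ℝ) (Np : ℕ → ℕ) (p : ℕ)
    (z : ℕ → X) : Measure ((ℕ → ℕ) × (ℕ → X)) :=
  (Measure.pi fun _ : Fin (Np (p + 1)) =>
      (cat (Np p) fun j => G p (z j)).bind fun a =>
        (M (p + 1) (z a)).map fun x => (a, x)).map fun f =>
    (padF fun i => (f i).1, padF fun i => (f i).2)

/-- The law of the particle system `(ζ, A)` run up to time `k`: the first component is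
`ζ : time → particle index → X`, the second is `A : time → particle index → ℕ`, where
`A p i` is the ancestor index of particle `i` of generation `p+1`. -/
def pfLaw [Nonempty X] (M0 : Measure X) (M : ℕ → Kernel X X) (G : ℕ → X → ℝ)
    (Np : ℕ → ℕ) : ℕ → Measure ((ℕ → ℕ → X) × (ℕ → ℕ → ℕ))
  | 0 =>
      (Measure.pi fun _ : Fin (Np 0) => M0).map fun f =>
        (fun p => if p = 0 then padF f else fun _ => Classical.arbitrary X, fun _ _ => 0)
  | k + 1 =>
      (pfLaw M0 M G Np k).bind fun ω =>
        (pfStep M G Np k (ω.1 k)).map fun az =>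
          (Function.update ω.1 (k + 1) az.2, Function.update ω.2 k az.1)

/-- Eve indices: `eve A 0 i = i` and `eve A (p+1) i = eve A p (A p i)`. -/
def eve (A : ℕ → ℕ → ℕ) : ℕ → ℕ → ℕ
  | 0 => fun i => i
  | p + 1 => fun i => eve A p (A p i)

/-- `η_n^N(φ)`. -/
def etaN (Np : ℕ → ℕ) (n : ℕ) (φ : X → ℝ) (ω : (ℕ → ℕ → X) × (ℕ → ℕ → ℕ)) : ℝ :=
  (Np n : ℝ)⁻¹ * ∑ i ∈ Finset.range (Np n), φ (ω.1 n i)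

/-- `γ_n^N(φ)`. -/
def gammaN (G : ℕ → X → ℝ) (Np : ℕ → ℕ) (n : ℕ) (φ : X → ℝ)
    (ω : (ℕ → ℕ → X) × (ℕ → ℕ → ℕ)) : ℝ :=
  (∏ p ∈ Finset.range n, etaN Np p (G p) ω) * etaN Np n φ ω

/-- The variance estimator `V_n^N(φ)`. -/
def Vest (Np : ℕ → ℕ) (n : ℕ) (φ : X → ℝ) (ω : (ℕ → ℕ → X) × (ℕ → ℕ → ℕ)) : ℝ :=
  etaN Np n φ ω ^ 2 -
    (∏ p ∈ Finset.range n, (Np p : ℝ) / ((Np p : ℝ) - 1)) *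
      ((Np n : ℝ) * ((Np n : ℝ) - 1))⁻¹ *
      ∑ i ∈ Finset.range (Np n), ∑ j ∈ Finset.range (Np n),
        if eve ω.2 n i ≠ eve ω.2 n j then φ (ω.1 n i) * φ (ω.1 n j) else 0

/-- Initial law of the doubled chain used to define `μ_b`. -/
def pairInit (M0 : Measure X) (b : ℕ → Bool) : Measure (X × X) :=
  if b 0 then M0.map fun x => (x, x) else M0.prod M0

/-- Transitions of the doubled chain used to define `μ_b`. -/
def pairKer (M : ℕ → Kernel X X) (b : ℕ → Bool) (p : ℕ) (q : X × X) : Measure (X × X) :=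
  if b p then (M p q.1).map fun y => (y, y) else (M p q.1).prod (M p q.2)

/-- `μ_b(φ) = E_b[φ(X_n, X_n') ∏_{p<n} G_p(X_p) G_p(X_p')]`. -/
def muB (M0 : Measure X) (M : ℕ → Kernel X X) (G : ℕ → X → ℝ) (n : ℕ) (b : ℕ → Bool)
    (φ : X × X → ℝ) : ℝ :=
  ∫ ω, φ (ω n) * ∏ p ∈ Finset.range n, G p (ω p).1 * G p (ω p).2
    ∂(markovPath (pairInit M0 b) (pairKer M b) n)

/-- `φ ⊗ φ`. -/
def tens (φ : X → ℝ) : X × X → ℝ := fun q => φ q.1 * φ q.2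

/-- The binary string `e_p`. -/
def eVec (p : ℕ) : ℕ → Bool := fun q => q == p

/-- The zero binary string `0_n`. -/
def zeroVec : ℕ → Bool := fun _ => false

/-- Extension of a finite binary string to `ℕ → Bool`. -/
def extB (n : ℕ) (b : Fin (n + 1) → Bool) : ℕ → Bool := fun p =>
  if h : p < n + 1 then b ⟨p, h⟩ else false

/-- `v_{p,n}(φ) = (μ_{e_p}(φ⊗φ) − μ_{0_n}(φ⊗φ)) / γ_n(1)²`. -/
def vpn (M0 : Measure X) (M : ℕ → Kernel X X) (G : ℕ → X → ℝ) (n p : ℕ) (φ : X → ℝ) : ℝ :=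
  (muB M0 M G n (eVec p) (tens φ) - muB M0 M G n zeroVec (tens φ)) / gInt M0 M G n 1 ^ 2

/-- `σ_n²(φ) = Σ_{p=0}^n c_p⁻¹ v_{p,n}(φ)`. -/
def sigma2 (M0 : Measure X) (M : ℕ → Kernel X X) (G : ℕ → X → ℝ) (c : ℕ → ℝ) (n : ℕ)
    (φ : X → ℝ) : ℝ :=
  ∑ p ∈ Finset.range (n + 1), (c p)⁻¹ * vpn M0 M G n p φ

/-- Particle numbers `N_p = ⌈c_p N⌉`. -/
def npart (c : ℕ → ℝ) (N : ℕ) (p : ℕ) : ℕ := ⌈c p * (N : ℝ)⌉₊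

/-- Backward tracing: `traceAux A n kn j = K_{n-j}` where `K_n = kn`, `K_p = A p (K_{p+1})`. -/
def traceAux (A : ℕ → ℕ → ℕ) (n kn : ℕ) : ℕ → ℕ
  | 0 => kn
  | j + 1 => A (n - (j + 1)) (traceAux A n kn j)

/-- The deterministic ancestral trace `K¹`: `trace A n kn p = K_p¹` given `K_n¹ = kn`. -/
def trace (A : ℕ → ℕ → ℕ) (n kn : ℕ) : ℕ → ℕ := fun p => traceAux A n kn (n - p)

/-- Conditional law of the broken-lineage trace `(K_0²,…,K_p²)` given `K_p² = v`
(entries above `p` are junk, to be overwritten). -/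
def k2Law (G : ℕ → X → ℝ) (Np : ℕ → ℕ) (ω : (ℕ → ℕ → X) × (ℕ → ℕ → ℕ)) (K1 : ℕ → ℕ) :
    ℕ → ℕ → Measure (ℕ → ℕ)
  | 0 => fun v => Measure.dirac fun q => if q = 0 then v else 0
  | p + 1 => fun v =>
      ((if v = K1 (p + 1) then cat (Np p) fun j => G p (ω.1 p j)
          else Measure.dirac (ω.2 p v)).bind fun w =>
        (k2Law G Np ω K1 p w).map fun f => Function.update f (p + 1) v)

/-- Conditional law of `(K¹, K²)` given the particle system `ω = (ζ, A)`. -/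
def kLaw (G : ℕ → X → ℝ) (Np : ℕ → ℕ) (n : ℕ) (ω : (ℕ → ℕ → X) × (ℕ → ℕ → ℕ)) :
    Measure ((ℕ → ℕ) × (ℕ → ℕ)) :=
  (unif (Np n)).bind fun k1n =>
    (unif (Np n)).bind fun k2n =>
      (k2Law G Np ω (trace ω.2 n k1n) n k2n).map fun k2 => (trace ω.2 n k1n, k2)

/-- Joint law of the particle system together with the tracing variables `(K¹, K²)`. -/
def pfkLaw [Nonempty X] (M0 : Measure X) (M : ℕ → Kernel X X) (G : ℕ → X → ℝ)
    (Np : ℕ → ℕ) (n : ℕ) :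
    Measure (((ℕ → ℕ → X) × (ℕ → ℕ → ℕ)) × ((ℕ → ℕ) × (ℕ → ℕ))) :=
  (pfLaw M0 M G Np n).bind fun ω => (kLaw G Np n ω).map fun k => (ω, k)

/-- `(k¹, k²) ∈ I(b)`. -/
def inI (Np : ℕ → ℕ) (n : ℕ) (b : ℕ → Bool) (k : (ℕ → ℕ) × (ℕ → ℕ)) : Prop :=
  ∀ p ≤ n, k.1 p < Np p ∧ k.2 p < Np p ∧ (k.1 p = k.2 p ↔ b p = true)

/-- The particle approximation `μ_b^N(φ)` (a function of the realization `ω = (ζ, A)`);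
the conditional expectation given `(A, ζ)` is the integral with respect to `kLaw`. -/
def muBN (G : ℕ → X → ℝ) (Np : ℕ → ℕ) (n : ℕ) (b : ℕ → Bool) (φ : X × X → ℝ)
    (ω : (ℕ → ℕ → X) × (ℕ → ℕ → ℕ)) : ℝ :=
  (∏ p ∈ Finset.range (n + 1),
      if b p then (Np p : ℝ) else (Np p : ℝ) / ((Np p : ℝ) - 1)) *
    gammaN G Np n 1 ω ^ 2 *
    ∫ k, (if inI Np n b k then (1 : ℝ) else 0) * φ (ω.1 n (k.1 n), ω.1 n (k.2 n))
      ∂(kLaw G Np n ω)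

/-- `v_{p,n}^N(φ)`. -/
def vpnN (G : ℕ → X → ℝ) (Np : ℕ → ℕ) (n p : ℕ) (φ : X → ℝ)
    (ω : (ℕ → ℕ → X) × (ℕ → ℕ → ℕ)) : ℝ :=
  (muBN G Np n (eVec p) (tens φ) ω - muBN G Np n zeroVec (tens φ) ω) / gammaN G Np n 1 ω ^ 2

/-- `v_n^N(φ) = Σ_{p=0}^n c_p⁻¹ v_{p,n}^N(φ)`. -/
def vnN (G : ℕ → X → ℝ) (Np : ℕ → ℕ) (c : ℕ → ℝ) (n : ℕ) (φ : X → ℝ)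
    (ω : (ℕ → ℕ → X) × (ℕ → ℕ → ℕ)) : ℝ :=
  ∑ p ∈ Finset.range (n + 1), (c p)⁻¹ * vpnN G Np n p φ ω

/-- `QAux M G n φ j = Q_{n-j,n}(φ)`. -/
def QAux (M : ℕ → Kernel X X) (G : ℕ → X → ℝ) (n : ℕ) (φ : X → ℝ) : ℕ → X → ℝ
  | 0 => φ
  | j + 1 => fun x => G (n - (j + 1)) x * ∫ y, QAux M G n φ j y ∂(M (n - j) x)

/-- `Q_{p,n}(φ)` where `Q_p(x, dx') = G_{p-1}(x) M_p(x, dx')`, `Q_{n,n} = Id`,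
`Q_{p,n} = Q_{p+1} ⋯ Q_n`. -/
def Qpn (M : ℕ → Kernel X X) (G : ℕ → X → ℝ) (n p : ℕ) (φ : X → ℝ) : X → ℝ :=
  QAux M G n φ (n - p)

/-- `φ̂ = G_n · φ`. -/
def hatf (G : ℕ → X → ℝ) (n : ℕ) (φ : X → ℝ) : X → ℝ := fun x => G n x * φ x

/-- `γ̂_n(φ) = γ_n(G_n φ)`. -/
def gHatInt (M0 : Measure X) (M : ℕ → Kernel X X) (G : ℕ → X → ℝ) (n : ℕ) (φ : X → ℝ) : ℝ :=
  gInt M0 M G n (hatf G n φ)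

/-- `η̂_n(φ) = γ̂_n(φ)/γ̂_n(1)`. -/
def eHatInt (M0 : Measure X) (M : ℕ → Kernel X X) (G : ℕ → X → ℝ) (n : ℕ) (φ : X → ℝ) : ℝ :=
  gHatInt M0 M G n φ / gHatInt M0 M G n 1

/-- `γ̂_n^N(φ) = γ_n^N(G_n φ)`. -/
def gammaHatN (G : ℕ → X → ℝ) (Np : ℕ → ℕ) (n : ℕ) (φ : X → ℝ)
    (ω : (ℕ → ℕ → X) × (ℕ → ℕ → ℕ)) : ℝ :=
  gammaN G Np n (hatf G n φ) ω

/-- `η̂_n^N(φ) = γ̂_n^N(φ)/γ̂_n^N(1)`. -/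
def etaHatN (G : ℕ → X → ℝ) (Np : ℕ → ℕ) (n : ℕ) (φ : X → ℝ)
    (ω : (ℕ → ℕ → X) × (ℕ → ℕ → ℕ)) : ℝ :=
  gammaHatN G Np n φ ω / gammaHatN G Np n 1 ω

/-- `v̂_{p,n}(φ) = v_{p,n}(φ̂)/η_n(G_n)²`. -/
def vpnHat (M0 : Measure X) (M : ℕ → Kernel X X) (G : ℕ → X → ℝ) (n p : ℕ) (φ : X → ℝ) : ℝ :=
  vpn M0 M G n p (hatf G n φ) / eInt M0 M G n (G n) ^ 2

/-- `σ̂_n²(φ) = Σ_{p=0}^n c_p⁻¹ v̂_{p,n}(φ)`. -/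
def sigma2Hat (M0 : Measure X) (M : ℕ → Kernel X X) (G : ℕ → X → ℝ) (c : ℕ → ℝ) (n : ℕ)
    (φ : X → ℝ) : ℝ :=
  ∑ p ∈ Finset.range (n + 1), (c p)⁻¹ * vpnHat M0 M G n p φ

/-- `V̂_n^N(φ) = V_n^N(φ̂)/η_n^N(G_n)²`. -/
def VestHat (G : ℕ → X → ℝ) (Np : ℕ → ℕ) (n : ℕ) (φ : X → ℝ)
    (ω : (ℕ → ℕ → X) × (ℕ → ℕ → ℕ)) : ℝ :=
  Vest Np n (hatf G n φ) ω / etaN Np n (G n) ω ^ 2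

/-- `v̂_{p,n}^N(φ) = v_{p,n}^N(φ̂)/η_n^N(G_n)²`. -/
def vpnHatN (G : ℕ → X → ℝ) (Np : ℕ → ℕ) (n p : ℕ) (φ : X → ℝ)
    (ω : (ℕ → ℕ → X) × (ℕ → ℕ → ℕ)) : ℝ :=
  vpnN G Np n p (hatf G n φ) ω / etaN Np n (G n) ω ^ 2

/-- `v̂_n^N(φ) = Σ_{p=0}^n c_p⁻¹ v̂_{p,n}^N(φ)`. -/
def vnHatN (G : ℕ → X → ℝ) (Np : ℕ → ℕ) (c : ℕ → ℝ) (n : ℕ) (φ : X → ℝ)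
    (ω : (ℕ → ℕ → X) × (ℕ → ℕ → ℕ)) : ℝ :=
  ∑ p ∈ Finset.range (n + 1), (c p)⁻¹ * vpnHatN G Np n p φ ω


open PFVar MeasureTheory ProbabilityTheory Filter

/-- Bounded measurable real-valued functions. -/
def BddMeas {Y : Type*} [MeasurableSpace Y] (f : Y → ℝ) : Prop :=
  Measurable f ∧ ∃ C, ∀ y, |f y| ≤ C

namespace BddMeas

variable {Y Z : Type*} [MeasurableSpace Y] [MeasurableSpace Z] {f g : Y → ℝ}

theorem integrable (hf : BddMeas f) (μ : Measure Y) [IsFiniteMeasure μ] : Integrable f μ := by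
  obtain ⟨hm, C, hC⟩ := hf
  exact Integrable.of_bound hm.aestronglyMeasurable C (ae_of_all _ hC)

theorem isFiniteMeasure_withDensity (hf : BddMeas f) (μ : Measure Y) [IsFiniteMeasure μ] :
    IsFiniteMeasure (μ.withDensity fun y => ENNReal.ofReal (f y)) :=
  isFiniteMeasure_withDensity_ofReal (hf.integrable μ).2

theorem const (c : ℝ) : BddMeas fun _ : Y => c :=
  ⟨measurable_const, |c|, fun _ => le_rfl⟩

theorem mul (hf : BddMeas f) (hg : BddMeas g) : BddMeas fun y => f y * g y := by
  obtain ⟨hf, C, hC⟩ := hf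
  obtain ⟨hg, D, hD⟩ := hg
  refine ⟨hf.mul hg, C * D, fun y => ?_⟩
  rw [abs_mul]
  exact mul_le_mul (hC y) (hD y) (abs_nonneg _) ((abs_nonneg _).trans (hC y))

theorem comp (hf : BddMeas f) {h : Z → Y} (hh : Measurable h) : BddMeas fun z => f (h z) := by
  obtain ⟨hf, C, hC⟩ := hf
  exact ⟨hf.comp hh, C, fun z => hC _⟩

theorem prod {ι : Type*} (s : Finset ι) {F : ι → Y → ℝ} (hF : ∀ i ∈ s, BddMeas (F i)) :
    BddMeas fun y => ∏ i ∈ s, F i y := by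
  induction s using Finset.induction_on with
  | empty => simpa using const 1
  | insert a s ha ih =>
    simp only [Finset.prod_insert ha]
    exact (hF a (Finset.mem_insert_self a s)).mul
      (ih fun i hi => hF i (Finset.mem_insert_of_mem hi))

theorem integral_kernel (hf : BddMeas f) (κ : Kernel Z Y) [IsMarkovKernel κ] :
    BddMeas fun z => ∫ y, f y ∂κ z := by
  obtain ⟨hf, C, hC⟩ := hf
  refine ⟨hf.stronglyMeasurable.integral_kernel.measurable, C, fun z => ?_⟩
  have h : ∀ᵐ y ∂κ z, ‖f y‖ ≤ C := ae_of_all _ hC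
  simpa using norm_integral_le_of_norm_le_const h

theorem integral_bind (hf : BddMeas f) (μ : Measure Z) [IsFiniteMeasure μ]
    (κ : Kernel Z Y) [IsMarkovKernel κ] :
    ∫ y, f y ∂(μ.bind κ) = ∫ z, ∫ y, f y ∂κ z ∂μ := by
  have hint : Integrable f (μ.bind κ) := hf.integrable _
  rw [Measure.comp_eq_comp_const_apply] at hint ⊢
  simpa using Kernel.integral_comp hint

end BddMeas

section MarkovPath

variable {Y : Type*} [MeasurableSpace Y]

theorem measurable_update_prod (k : ℕ) :
    Measurable fun q : (ℕ → Y) × Y => Function.update q.1 k q.2 := by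
  refine measurable_pi_iff.2 fun i => ?_
  by_cases h : i = k
  · subst h
    simpa using measurable_snd
  · simp only [Function.update_of_ne h]
    fun_prop

/-- The kernel extending a path up to time `k` by one transition of `κ`. -/
def pathStep (κ : Kernel Y Y) (k : ℕ) : Kernel (ℕ → Y) (ℕ → Y) :=
  (Kernel.id ×ₖ κ.comap (fun ω : ℕ → Y => ω k) (measurable_pi_apply k)).map
    fun q => Function.update q.1 (k + 1) q.2

instance (κ : Kernel Y Y) [IsMarkovKernel κ] (k : ℕ) : IsMarkovKernel (pathStep κ k) :=
  Kernel.IsMarkovKernel.map _ (measurable_update_prod (k + 1))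

theorem pathStep_apply (κ : Kernel Y Y) [IsMarkovKernel κ] (k : ℕ) (ω : ℕ → Y) :
    pathStep κ k ω = (κ (ω k)).map fun y => Function.update ω (k + 1) y := by
  rw [pathStep, Kernel.map_apply _ (measurable_update_prod (k + 1)), Kernel.prod_apply,
    Kernel.id_apply, Kernel.comap_apply, Measure.dirac_prod,
    Measure.map_map (measurable_update_prod (k + 1)) measurable_prodMk_left]
  rfl

theorem markovPath_succ (μ0 : Measure Y) (κ : ℕ → Kernel Y Y) [∀ p, IsMarkovKernel (κ p)]
    (k : ℕ) :
    markovPath μ0 (fun p y => κ p y) (k + 1)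
      = (markovPath μ0 (fun p y => κ p y) k).bind (pathStep (κ (k + 1)) k) := by
  rw [markovPath]
  congr 1
  funext ω
  rw [pathStep_apply]

instance (μ0 : Measure Y) [IsProbabilityMeasure μ0] (κ : ℕ → Kernel Y Y)
    [∀ p, IsMarkovKernel (κ p)] (k : ℕ) :
    IsProbabilityMeasure (markovPath μ0 (fun p y => κ p y) k) := by
  induction k with
  | zero => exact Measure.isProbabilityMeasure_map (by fun_prop)
  | succ k ih =>
    rw [markovPath_succ]
    infer_instance

theorem integral_markovPath_zero (μ0 : Measure Y) (κ : ℕ → Y → Measure Y) {ψ : Y → ℝ}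
    (hψ : Measurable ψ) :
    ∫ ω, ψ (ω 0) ∂(markovPath μ0 κ 0) = ∫ y, ψ y ∂μ0 := by
  have h : Measurable fun ω : ℕ → Y => ψ (ω 0) := hψ.comp (measurable_pi_apply 0)
  rw [markovPath, integral_map (by fun_prop) h.aestronglyMeasurable]

theorem integral_markovPath_succ (μ0 : Measure Y) [IsProbabilityMeasure μ0]
    (κ : ℕ → Kernel Y Y) [∀ p, IsMarkovKernel (κ p)] {k : ℕ} {H : ℕ → Y → ℝ}
    (hH : ∀ p ≤ k, BddMeas (H p)) {ψ : Y → ℝ} (hψ : BddMeas ψ) :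
    ∫ ω, ψ (ω (k + 1)) * ∏ p ∈ Finset.range (k + 1), H p (ω p)
        ∂(markovPath μ0 (fun p y => κ p y) (k + 1))
      = ∫ ω, (H k (ω k) * ∫ y, ψ y ∂κ (k + 1) (ω k)) * ∏ p ∈ Finset.range k, H p (ω p)
        ∂(markovPath μ0 (fun p y => κ p y) k) := by
  have hF : BddMeas fun ω : ℕ → Y =>
      ψ (ω (k + 1)) * ∏ p ∈ Finset.range (k + 1), H p (ω p) :=
    (hψ.comp (measurable_pi_apply _)).mul <| BddMeas.prod _ fun p hp =>
      (hH p (Nat.lt_succ_iff.1 (Finset.mem_range.1 hp))).comp (measurable_pi_apply p)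
  rw [markovPath_succ, hF.integral_bind]
  congr 1
  funext ω
  rw [pathStep_apply, integral_map (measurable_update _).aemeasurable
    hF.1.aestronglyMeasurable]
  have hprod (y : Y) : ∏ p ∈ Finset.range (k + 1), H p (Function.update ω (k + 1) y p)
      = ∏ p ∈ Finset.range (k + 1), H p (ω p) :=
    Finset.prod_congr rfl fun p hp => by
      rw [Function.update_of_ne (Finset.mem_range.1 hp).ne]
  simp only [hprod, Function.update_self, integral_mul_const, Finset.prod_range_succ]
  ring

end MarkovPath

/-- The kernel whose measures are `pairKer M b p`. -/
def pairKernel (M : ℕ → Kernel X X) (b : ℕ → Bool) (p : ℕ) : Kernel (X × X) (X × X) :=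
  if b p then ((M p).comap Prod.fst measurable_fst).map fun y => (y, y)
  else Kernel.parallelComp (M p) (M p)

theorem pairKernel_apply (M : ℕ → Kernel X X) [∀ p, IsMarkovKernel (M p)] (b : ℕ → Bool)
    (p : ℕ) (q : X × X) : pairKernel M b p q = pairKer M b p q := by
  unfold pairKernel pairKer
  split
  · rw [Kernel.map_apply _ (by fun_prop), Kernel.comap_apply]
  · rw [Kernel.parallelComp_apply]

instance (M : ℕ → Kernel X X) [∀ p, IsMarkovKernel (M p)] (b : ℕ → Bool) (p : ℕ) :
    IsMarkovKernel (pairKernel M b p) := by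
  unfold pairKernel
  split
  · exact Kernel.IsMarkovKernel.map _ (by fun_prop)
  · infer_instance

instance (M0 : Measure X) [IsProbabilityMeasure M0] (b : ℕ → Bool) :
    IsProbabilityMeasure (pairInit M0 b) := by
  unfold pairInit
  split
  · exact Measure.isProbabilityMeasure_map (by fun_prop)
  · infer_instance

/-- `fkStep M G k f = Q_{k+1}(f)`. -/
def fkStep (M : ℕ → Kernel X X) (G : ℕ → X → ℝ) (k : ℕ) (f : X → ℝ) : X → ℝ :=
  fun x => G k x * ∫ y, f y ∂M (k + 1) x

section FeynmanKac

variable {M0 : Measure X} [IsProbabilityMeasure M0]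
  {M : ℕ → Kernel X X} [∀ p, IsMarkovKernel (M p)] {G : ℕ → X → ℝ}

theorem BddMeas.tensor {f g : X → ℝ} (hf : BddMeas f) (hg : BddMeas g) :
    BddMeas fun q : X × X => f q.1 * g q.2 :=
  (hf.comp measurable_fst).mul (hg.comp measurable_snd)

theorem BddMeas.fkStep {k : ℕ} (hG : BddMeas (G k)) {f : X → ℝ} (hf : BddMeas f) :
    BddMeas (fkStep M G k f) :=
  hG.mul (hf.integral_kernel _)

theorem Qpn_self (M : ℕ → Kernel X X) (G : ℕ → X → ℝ) (n : ℕ) (φ : X → ℝ) :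
    Qpn M G n n φ = φ := by
  simp [Qpn, QAux]

theorem Qpn_of_lt (M : ℕ → Kernel X X) (G : ℕ → X → ℝ) {n k : ℕ} (hk : k < n) (φ : X → ℝ) :
    Qpn M G n k φ = fkStep M G k (Qpn M G n (k + 1) φ) := by
  obtain ⟨j, rfl⟩ := Nat.exists_eq_add_of_lt hk
  have h1 : k + j + 1 - k = j + 1 := by omega
  have h2 : k + j + 1 - (k + 1) = j := by omega
  have h3 : k + j + 1 - (j + 1) = k := by omega
  have h4 : k + j + 1 - j = k + 1 := by omega
  funext x
  simp only [Qpn, h1, h2, QAux, h3, h4, fkStep]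

theorem BddMeas.Qpn {n k : ℕ} (hk : k ≤ n) (hG : ∀ p < n, BddMeas (G p)) {φ : X → ℝ}
    (hφ : BddMeas φ) : BddMeas (Qpn M G n k φ) := by
  induction hk using Nat.decreasingInduction with
  | self => rwa [Qpn_self]
  | of_succ k hk ih =>
    rw [Qpn_of_lt M G hk]
    exact (hG k hk).fkStep ih

theorem isFiniteMeasure_gammaFK {k : ℕ} (hG : ∀ p < k, BddMeas (G p)) :
    IsFiniteMeasure (gammaFK M0 M G k) := by
  induction k with
  | zero => rw [gammaFK]; infer_instance
  | succ k ih =>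
    have := ih fun p hp => hG p (hp.trans k.lt_succ_self)
    have := (hG k k.lt_succ_self).isFiniteMeasure_withDensity (gammaFK M0 M G k)
    rw [gammaFK]
    infer_instance

theorem gInt_succ {k : ℕ} (hG : ∀ p ≤ k, BddMeas (G p)) (hpos : ∀ x, 0 < G k x) {f : X → ℝ}
    (hf : BddMeas f) : gInt M0 M G (k + 1) f = gInt M0 M G k (fkStep M G k f) := by
  have := isFiniteMeasure_gammaFK (M0 := M0) (M := M) fun p (hp : p < k) => hG p hp.le
  have := (hG k le_rfl).isFiniteMeasure_withDensity (gammaFK M0 M G k)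
  rw [gInt, gammaFK, hf.integral_bind, integral_withDensity_eq_integral_toReal_smul
    (hG k le_rfl).1.ennreal_ofReal (ae_of_all _ fun _ => ENNReal.ofReal_lt_top)]
  simp only [ENNReal.toReal_ofReal (hpos _).le, smul_eq_mul, gInt, fkStep]

theorem gInt_Qpn {n k : ℕ} (hk : k ≤ n) (hG : ∀ p < n, BddMeas (G p))
    (hpos : ∀ p < n, ∀ x, 0 < G p x) {φ : X → ℝ} (hφ : BddMeas φ) :
    gInt M0 M G k (Qpn M G n k φ) = gInt M0 M G n φ := by
  induction hk using Nat.decreasingInduction with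
  | self => rw [Qpn_self]
  | of_succ k hk ih =>
    rw [Qpn_of_lt M G hk, ← gInt_succ (fun p hp => hG p (hp.trans_lt hk)) (hpos k hk)
      (hφ.Qpn hk hG), ih]

theorem muB_zero (M0 : Measure X) (M : ℕ → Kernel X X) (G : ℕ → X → ℝ) (b : ℕ → Bool)
    {ψ : X × X → ℝ} (hψ : Measurable ψ) :
    muB M0 M G 0 b ψ = ∫ q, ψ q ∂(pairInit M0 b) := by
  simpa [muB] using integral_markovPath_zero (pairInit M0 b) (pairKer M b) hψ

theorem muB_succ {k : ℕ} (hG : ∀ p ≤ k, BddMeas (G p)) (b : ℕ → Bool)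
    {ψ : X × X → ℝ} (hψ : BddMeas ψ) :
    muB M0 M G (k + 1) b ψ
      = muB M0 M G k b fun q => tens (G k) q * ∫ r, ψ r ∂pairKer M b (k + 1) q := by
  have h := integral_markovPath_succ (pairInit M0 b) (pairKernel M b) (k := k)
    (H := fun p => tens (G p)) (fun p hp => (hG p hp).tensor (hG p hp)) hψ
  simp only [pairKernel_apply] at h
  exact h

theorem muB_succ_tensor_of_false {k : ℕ} (hG : ∀ p ≤ k, BddMeas (G p)) {b : ℕ → Bool}
    (hb : b (k + 1) = false) {f g : X → ℝ} (hf : BddMeas f) (hg : BddMeas g) :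
    muB M0 M G (k + 1) b (fun q => f q.1 * g q.2)
      = muB M0 M G k b fun q => fkStep M G k f q.1 * fkStep M G k g q.2 := by
  rw [muB_succ hG b (hf.tensor hg)]
  congr 1
  funext q
  simp only [pairKer, hb, Bool.false_eq_true, if_false, integral_prod_mul, tens, fkStep]
  ring

theorem muB_tensor_of_forall_false {k : ℕ} (hG : ∀ p < k, BddMeas (G p))
    (hpos : ∀ p < k, ∀ x, 0 < G p x) {b : ℕ → Bool} (hb : ∀ p ≤ k, b p = false)
    {f g : X → ℝ} (hf : BddMeas f) (hg : BddMeas g) :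
    muB M0 M G k b (fun q => f q.1 * g q.2) = gInt M0 M G k f * gInt M0 M G k g := by
  induction k generalizing f g with
  | zero =>
    rw [muB_zero _ _ _ _ (hf.tensor hg).1]
    simp only [pairInit, hb 0 le_rfl, Bool.false_eq_true, if_false, integral_prod_mul, gInt,
      gammaFK]
  | succ k ih =>
    have hG' : ∀ p ≤ k, BddMeas (G p) := fun p hp => hG p (Nat.lt_succ_of_le hp)
    have hk := hpos k k.lt_succ_self
    rw [muB_succ_tensor_of_false hG' (hb _ le_rfl) hf hg,
      ih (fun p hp => hG' p hp.le) (fun p hp => hpos p (hp.trans k.lt_succ_self))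
        (fun p hp => hb p (hp.trans k.le_succ)) ((hG' k le_rfl).fkStep hf)
        ((hG' k le_rfl).fkStep hg), ← gInt_succ hG' hk hf, ← gInt_succ hG' hk hg]

theorem muB_tens_eq_muB_tens_Qpn {n k : ℕ} (hk : k ≤ n) (hG : ∀ p < n, BddMeas (G p))
    {b : ℕ → Bool} (hb : ∀ p, k < p → b p = false) {φ : X → ℝ} (hφ : BddMeas φ) :
    muB M0 M G n b (tens φ) = muB M0 M G k b (tens (Qpn M G n k φ)) := by
  induction hk using Nat.decreasingInduction with
  | self => rw [Qpn_self]
  | of_succ k hk ih =>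
    have hQ : BddMeas (Qpn M G n (k + 1) φ) := hφ.Qpn hk hG
    rw [ih fun p hp => hb p (k.lt_succ_self.trans hp), Qpn_of_lt M G hk]
    exact muB_succ_tensor_of_false (fun p hp => hG p (hp.trans_lt hk))
      (hb _ k.lt_succ_self) hQ hQ

theorem muB_eVec_self_tens {k : ℕ} (hG : ∀ p < k, BddMeas (G p))
    (hpos : ∀ p < k, ∀ x, 0 < G p x) {ψ : X → ℝ} (hψ : BddMeas ψ) :
    muB M0 M G k (eVec k) (tens ψ)
      = gInt M0 M G k (1 : X → ℝ) * gInt M0 M G k fun x => ψ x ^ 2 := by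
  have hsq : BddMeas fun x => ψ x ^ 2 := by simpa only [sq] using hψ.mul hψ
  have hone : BddMeas (1 : X → ℝ) := BddMeas.const 1
  have htens : BddMeas (tens ψ) := hψ.tensor hψ
  have hdiag (μ : Measure X) : ∫ r, tens ψ r ∂(μ.map fun y => (y, y)) = ∫ y, ψ y ^ 2 ∂μ := by
    rw [integral_map (by fun_prop) htens.1.aestronglyMeasurable]
    simp only [tens, sq]
  cases k with
  | zero =>
    rw [muB_zero _ _ _ _ htens.1]
    simp [pairInit, eVec, hdiag, gInt, gammaFK]
  | succ k =>
    have hG' : ∀ p ≤ k, BddMeas (G p) := fun p hp => hG p (Nat.lt_succ_of_le hp)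
    have hk := hpos k k.lt_succ_self
    have hfun : (fun q => tens (G k) q * ∫ r, tens ψ r ∂pairKer M (eVec (k + 1)) (k + 1) q)
        = fun q => fkStep M G k (fun x => ψ x ^ 2) q.1 * fkStep M G k 1 q.2 := by
      funext q
      simp only [pairKer, eVec, BEq.rfl, if_true, hdiag]
      simp only [tens, fkStep, Pi.one_apply, integral_const, probReal_univ, smul_eq_mul]
      ring
    rw [muB_succ hG' _ htens, hfun, muB_tensor_of_forall_false (fun p hp => hG' p hp.le)
      (fun p hp => hpos p (hp.trans k.lt_succ_self))
      (fun p hp => by simpa [eVec] using (Nat.lt_succ_of_le hp).ne)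
      ((hG' k le_rfl).fkStep hsq) ((hG' k le_rfl).fkStep hone), ← gInt_succ hG' hk hsq,
      ← gInt_succ hG' hk hone, mul_comm]

end FeynmanKac

theorem statement10
    {X : Type*} [MeasurableSpace X] (hX : ∃ x y : X, x ≠ y) (n : ℕ)
    (M0 : Measure X) [IsProbabilityMeasure M0]
    (M : ℕ → Kernel X X) [∀ p, IsMarkovKernel (M p)]
    (G : ℕ → X → ℝ) (hGm : ∀ p ≤ n, Measurable (G p))
    (hGpos : ∀ p ≤ n, ∀ x, 0 < G p x) (hGbd : ∀ p ≤ n, ∃ C, ∀ x, G p x ≤ C)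
    (φ : X → ℝ) (hφm : Measurable φ) (hφb : ∃ C, ∀ x, |φ x| ≤ C)
    (p : ℕ) (hp : p ≤ n) :
    muB M0 M G n (eVec p) (tens φ)
      = gInt M0 M G p (1 : X → ℝ) * gInt M0 M G p (fun x => Qpn M G n p φ x ^ 2) ∧
    vpn M0 M G n p φ
      = eInt M0 M G p (fun x => Qpn M G n p φ x ^ 2)
          / eInt M0 M G p (Qpn M G n p (1 : X → ℝ)) ^ 2
        - eInt M0 M G n φ ^ 2 := by
  have hG : ∀ q < n, BddMeas (G q) := fun q hq => by
    obtain ⟨C, hC⟩ := hGbd q hq.le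
    exact ⟨hGm q hq.le, C, fun x => (abs_of_pos (hGpos q hq.le x)).trans_le (hC x)⟩
  have hpos : ∀ q < n, ∀ x, 0 < G q x := fun q hq => hGpos q hq.le
  have hφ : BddMeas φ := ⟨hφm, hφb⟩
  have hone : BddMeas (1 : X → ℝ) := BddMeas.const 1
  have hdiag : muB M0 M G n (eVec p) (tens φ)
      = gInt M0 M G p (1 : X → ℝ) * gInt M0 M G p (fun x => Qpn M G n p φ x ^ 2) := by
    rw [muB_tens_eq_muB_tens_Qpn hp hG (fun q hq => by simpa [eVec] using hq.ne') hφ]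
    exact muB_eVec_self_tens (fun q hq => hG q (hq.trans_le hp))
      (fun q hq => hpos q (hq.trans_le hp)) (hφ.Qpn hp hG)
  refine ⟨hdiag, ?_⟩
  have hzero : muB M0 M G n zeroVec (tens φ) = gInt M0 M G n φ * gInt M0 M G n φ :=
    muB_tensor_of_forall_false hG hpos (fun _ _ => rfl) hφ hφ
  have hQone : gInt M0 M G p (Qpn M G n p 1) = gInt M0 M G n 1 := gInt_Qpn hp hG hpos hone
  have := isFiniteMeasure_gammaFK (M0 := M0) (M := M) fun q (hq : q < p) => hG q (hq.trans_le hp)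
  simp only [vpn, eInt, hdiag, hzero, hQone]
  by_cases h0 : gInt M0 M G p 1 = 0
  · have hγ : gammaFK M0 M G p = 0 := by
      simpa [gInt, measureReal_def, ENNReal.toReal_eq_zero_iff, measure_ne_top] using h0
    have hn : gInt M0 M G n 1 = 0 := by rw [← hQone, gInt, hγ, integral_zero_measure]
    simp [hn]
  · by_cases hn : gInt M0 M G n 1 = 0
    · simp [hn]
    · field_simp
end PFVar
end
end

section
/- Almost surely, for any bounded measurable function φ on X: γ_n^N(φ)² = Σ_{b ∈ B_n} [Π_{p=0}^n (1/N_p)^{b_p} (1 − 1/N_p)^{1−b_p}] μ_b^N(φ⊗φ). -/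
open MeasureTheory ProbabilityTheory Filter
open scoped ENNReal NNReal Classical

noncomputable section

namespace PFVar

variable {X : Type*} [MeasurableSpace X]

open PFVar MeasureTheory ProbabilityTheory Filter

/-- A measurable property that holds almost surely under almost every `k a` holds almost surely
under `m.bind k`; no measurability of `k` is needed. -/
theorem ae_bind_of_ae_ae {α β : Type*} [MeasurableSpace α] [MeasurableSpace β] {m : Measure α}
    {k : α → Measure β} {P : β → Prop} (hP : MeasurableSet {x | P x})
    (h : ∀ᵐ a ∂m, ∀ᵐ x ∂k a, P x) : ∀ᵐ x ∂m.bind k, P x := by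
  have h0 : m.bind k {x | P x}ᶜ ≤ 0 := by
    refine (Measure.bind_apply_le k hP.compl).trans_eq ?_
    rw [← lintegral_zero (μ := m)]
    exact lintegral_congr_ae h
  exact nonpos_iff_eq_zero.1 h0

/-- A measurable property of `f x` that holds for almost every `x` holds almost surely under
`m.map f`; no measurability of `f` is needed. -/
theorem ae_map_of_ae {α β : Type*} [MeasurableSpace α] [MeasurableSpace β] {m : Measure α}
    {f : α → β} {P : β → Prop} (hP : MeasurableSet {x | P x})
    (h : ∀ᵐ a ∂m, P (f a)) : ∀ᵐ x ∂m.map f, P x := by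
  by_cases hf : AEMeasurable f m
  · exact (ae_map_iff hf hP).2 h
  · simp [Measure.map_of_not_aemeasurable hf]

theorem ae_cat_lt (m : ℕ) (w : ℕ → ℝ) : ∀ᵐ j ∂cat m w, j < m := by
  refine Measure.ae_smul_measure ?_ _
  rw [ae_iff, Measure.coe_finsetSum, Finset.sum_apply]
  refine Finset.sum_eq_zero fun j hj => ?_
  simp [Finset.mem_range.1 hj]

theorem isProbabilityMeasure_cat {m : ℕ} {w : ℕ → ℝ} (hm : 0 < m) (hw : ∀ j, 0 < w j) :
    IsProbabilityMeasure (cat m w) := by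
  constructor
  simp only [cat, Measure.smul_apply, Measure.coe_finsetSum, Finset.sum_apply, measure_univ,
    smul_eq_mul, mul_one]
  refine ENNReal.inv_mul_cancel ?_ (by simp)
  simpa [Finset.sum_eq_zero_iff] using ⟨0, hm, hw 0⟩

theorem isProbabilityMeasure_unif {m : ℕ} (hm : 0 < m) : IsProbabilityMeasure (unif m) :=
  isProbabilityMeasure_cat hm fun _ => one_pos

theorem integral_unif (m : ℕ) (f : ℕ → ℝ) :
    ∫ i, f i ∂unif m = (m : ℝ)⁻¹ * ∑ i ∈ Finset.range m, f i := by
  rw [unif, cat, integral_smul_measure, integral_finsetSum_measure]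
  · simp
  · intro i _
    exact (integrable_dirac (by simp)).smul_measure (by simp)

section ParticleSystem

variable [Nonempty X] {M0 : Measure X} {M : ℕ → Kernel X X} {G : ℕ → X → ℝ} {Np : ℕ → ℕ}

theorem ae_pfStep_ancestor_lt [∀ p, IsMarkovKernel (M p)] {p : ℕ} (hN : 0 < Np p)
    (hG : ∀ x, 0 < G p x) (z : ℕ → X) :
    ∀ᵐ az ∂pfStep M G Np p z, ∀ i < Np (p + 1), az.1 i < Np p := by
  have hcat := isProbabilityMeasure_cat hN fun j => hG (z j)
  have hfac : IsProbabilityMeasure ((cat (Np p) fun j => G p (z j)).bind fun a =>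
      (M (p + 1) (z a)).map fun x => (a, x)) :=
    isProbabilityMeasure_bind Measurable.of_discrete.aemeasurable
      (ae_of_all _ fun a => Measure.isProbabilityMeasure_map (by fun_prop))
  refine ae_map_of_ae ?_ ?_
  · exact (Measurable.forall fun i => Measurable.forall fun _ =>
      measurableSet_setOfPred.1 (measurableSet_lt (by fun_prop) measurable_const)).setOf
  have hlt : ∀ᵐ q ∂((cat (Np p) fun j => G p (z j)).bind fun a =>
      (M (p + 1) (z a)).map fun x => (a, x)), q.1 < Np p := by
    have hmeas : MeasurableSet {q : ℕ × X | q.1 < Np p} :=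
      measurableSet_lt measurable_fst measurable_const
    refine ae_bind_of_ae_ae hmeas ?_
    filter_upwards [ae_cat_lt (Np p) fun j => G p (z j)] with a ha
    exact ae_map_of_ae hmeas (ae_of_all _ fun _ => ha)
  have hall := ae_all_iff.2 fun i : Fin (Np (p + 1)) =>
    (Measure.tendsto_eval_ae_ae (μ := fun _ : Fin (Np (p + 1)) =>
      ((cat (Np p) fun j => G p (z j)).bind fun a =>
        (M (p + 1) (z a)).map fun x => (a, x))) (i := i)).eventually hlt
  filter_upwards [hall] with f hf i hi
  simpa [padF, hi] using hf ⟨i, hi⟩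

/-- Almost surely every ancestor index points to an existing particle. -/
theorem ae_pfLaw_ancestor_lt [∀ p, IsMarkovKernel (M p)] (n : ℕ) (hN : ∀ p < n, 0 < Np p)
    (hG : ∀ p < n, ∀ x, 0 < G p x) :
    ∀ᵐ ω ∂pfLaw M0 M G Np n, ∀ p < n, ∀ i < Np (p + 1), ω.2 p i < Np p := by
  induction n with
  | zero => simp
  | succ n ih =>
    have hmeas : MeasurableSet {ω : (ℕ → ℕ → X) × (ℕ → ℕ → ℕ) |
        ∀ p < n + 1, ∀ i < Np (p + 1), ω.2 p i < Np p} :=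
      (Measurable.forall fun p => Measurable.forall fun _ => Measurable.forall fun i =>
        Measurable.forall fun _ =>
          measurableSet_setOfPred.1 (measurableSet_lt (by fun_prop) measurable_const)).setOf
    refine ae_bind_of_ae_ae hmeas ?_
    filter_upwards [ih (fun p hp => hN p (by omega)) fun p hp => hG p (by omega)] with ω hω
    refine ae_map_of_ae hmeas ?_
    filter_upwards [ae_pfStep_ancestor_lt (M := M) (hN n (by omega)) (hG n (by omega)) (ω.1 n)]
      with az haz p hp i hi
    rcases eq_or_ne p n with rfl | hpn
    · simpa using haz i hi
    · simpa [Function.update_of_ne hpn] using hω p (by omega) i hi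

end ParticleSystem

theorem trace_lt {A : ℕ → ℕ → ℕ} {Np : ℕ → ℕ} {n kn : ℕ}
    (hA : ∀ p < n, ∀ i < Np (p + 1), A p i < Np p) (hk : kn < Np n) {p : ℕ} (hp : p ≤ n) :
    trace A n kn p < Np p := by
  have aux : ∀ j ≤ n, traceAux A n kn j < Np (n - j) := by
    intro j
    induction j with
    | zero => simpa [traceAux] using hk
    | succ j ih =>
      intro hj
      refine hA _ (by omega) _ ?_
      rw [show n - (j + 1) + 1 = n - j by omega]
      exact ih (by omega)
  have h := aux (n - p) (by omega)
  rwa [show n - (n - p) = p by omega] at h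

theorem trace_self (A : ℕ → ℕ → ℕ) (n kn : ℕ) : trace A n kn n = kn := by
  simp [trace, traceAux]

section Tracing

variable {Y : Type*} {G : ℕ → Y → ℝ} {Np : ℕ → ℕ} {ω : (ℕ → ℕ → Y) × (ℕ → ℕ → ℕ)}

theorem isProbabilityMeasure_k2Law (K1 : ℕ → ℕ) (p v : ℕ) (hN : ∀ q < p, 0 < Np q)
    (hG : ∀ q < p, ∀ x, 0 < G q x) : IsProbabilityMeasure (k2Law G Np ω K1 p v) := by
  induction p generalizing v with
  | zero => exact Measure.dirac.isProbabilityMeasure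
  | succ p ih =>
    have ih' := fun w => ih w (fun q hq => hN q (by omega)) fun q hq => hG q (by omega)
    have hstep : IsProbabilityMeasure (if v = K1 (p + 1) then cat (Np p) fun j => G p (ω.1 p j)
        else Measure.dirac (ω.2 p v)) := by
      split_ifs
      · exact isProbabilityMeasure_cat (hN p (by omega)) fun j => hG p (by omega) _
      · infer_instance
    refine isProbabilityMeasure_bind Measurable.of_discrete.aemeasurable (ae_of_all _ fun w => ?_)
    have := ih' w
    exact Measure.isProbabilityMeasure_map (by fun_prop)

theorem ae_k2Law_self (K1 : ℕ → ℕ) (p v : ℕ) : ∀ᵐ f ∂k2Law G Np ω K1 p v, f p = v := by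
  have hmeas : MeasurableSet {f : ℕ → ℕ | f p = v} :=
    measurableSet_eq_fun (measurable_pi_apply p) measurable_const
  cases p with
  | zero =>
    rw [k2Law, ae_dirac_iff hmeas]
    simp
  | succ p =>
    exact ae_bind_of_ae_ae hmeas (ae_of_all _ fun w =>
      ae_map_of_ae hmeas (ae_of_all _ fun f => by simp))

theorem measurableSet_forall_le_lt (Np : ℕ → ℕ) (p : ℕ) :
    MeasurableSet {f : ℕ → ℕ | ∀ q ≤ p, f q < Np q} :=
  (Measurable.forall fun q => Measurable.forall fun _ =>
    measurableSet_setOfPred.1 (measurableSet_lt (measurable_pi_apply q) measurable_const)).setOf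

theorem ae_k2Law_lt (K1 : ℕ → ℕ) {p v : ℕ}
    (hA : ∀ q < p, ∀ i < Np (q + 1), ω.2 q i < Np q) (hv : v < Np p) :
    ∀ᵐ f ∂k2Law G Np ω K1 p v, ∀ q ≤ p, f q < Np q := by
  induction p generalizing v with
  | zero =>
    rw [k2Law, ae_dirac_iff (measurableSet_forall_le_lt Np 0)]
    simpa using hv
  | succ p ih =>
    have hmeas := measurableSet_forall_le_lt Np (p + 1)
    refine ae_bind_of_ae_ae hmeas ?_
    have hstep : ∀ᵐ w ∂(if v = K1 (p + 1) then cat (Np p) fun j => G p (ω.1 p j)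
        else Measure.dirac (ω.2 p v)), w < Np p := by
      split_ifs
      · exact ae_cat_lt _ _
      · rw [ae_dirac_eq]
        exact hA p (by omega) v hv
    filter_upwards [hstep] with w hw
    refine ae_map_of_ae hmeas ?_
    filter_upwards [ih (fun q hq => hA q (by omega)) hw] with f hf q hq
    rcases eq_or_ne q (p + 1) with rfl | hne
    · simpa using hv
    · simpa [Function.update_of_ne hne] using hf q (by omega)

theorem ae_kLaw_lt {n : ℕ} (hA : ∀ q < n, ∀ i < Np (q + 1), ω.2 q i < Np q) :
    ∀ᵐ k ∂kLaw G Np n ω, ∀ p ≤ n, k.1 p < Np p ∧ k.2 p < Np p := by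
  have hmeas : MeasurableSet {k : (ℕ → ℕ) × (ℕ → ℕ) | ∀ p ≤ n, k.1 p < Np p ∧ k.2 p < Np p} :=
    (Measurable.forall fun p => Measurable.forall fun _ => Measurable.and
      (measurableSet_setOfPred.1 (measurableSet_lt (by fun_prop) measurable_const))
      (measurableSet_setOfPred.1 (measurableSet_lt (by fun_prop) measurable_const))).setOf
  refine ae_bind_of_ae_ae hmeas ?_
  filter_upwards [ae_cat_lt (Np n) fun _ => 1] with i hi
  refine ae_bind_of_ae_ae hmeas ?_
  filter_upwards [ae_cat_lt (Np n) fun _ => 1] with j hj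
  refine ae_map_of_ae hmeas ?_
  filter_upwards [ae_k2Law_lt (trace ω.2 n i) hA hj] with f hf p hp
  exact ⟨trace_lt hA hi hp, hf p hp⟩

/-- Under the tracing law the terminal indices are independent and uniform. -/
theorem map_kLaw_terminal {n : ℕ} (hN : ∀ p ≤ n, 0 < Np p) (hG : ∀ p < n, ∀ x, 0 < G p x) :
    (kLaw G Np n ω).map (fun k => (k.1 n, k.2 n)) = (unif (Np n)).prod (unif (Np n)) := by
  have hu := isProbabilityMeasure_unif (hN n le_rfl)
  have hg : Measurable fun k : (ℕ → ℕ) × (ℕ → ℕ) => (k.1 n, k.2 n) := by fun_prop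
  ext s hs
  rw [Measure.map_apply hg hs, Measure.prod_apply hs, kLaw,
    Measure.bind_apply (hg hs) Measurable.of_discrete.aemeasurable]
  refine lintegral_congr fun i => ?_
  rw [Measure.bind_apply (hg hs) Measurable.of_discrete.aemeasurable,
    ← lintegral_indicator_one (measurable_prodMk_left hs)]
  refine lintegral_congr fun j => ?_
  have hk := isProbabilityMeasure_k2Law (ω := ω) (trace ω.2 n i) n j
    (fun q hq => hN q hq.le) hG
  rw [Measure.map_apply (by fun_prop) (hg hs)]
  have hself := ae_k2Law_self (G := G) (Np := Np) (ω := ω) (trace ω.2 n i) n j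
  by_cases hij : (i, j) ∈ s
  · rw [Set.indicator_of_mem (by exact hij), Pi.one_apply, ← mem_ae_iff_prob_eq_one
      (measurable_prodMk_left (hg hs))]
    filter_upwards [hself] with f hf
    simpa [trace_self, hf] using hij
  · rw [Set.indicator_of_notMem (by exact hij)]
    refine measure_mono_null (fun f hf (hfj : f n = j) => hij ?_) (ae_iff.1 hself)
    simpa [trace_self, hfj] using hf

theorem isProbabilityMeasure_kLaw {n : ℕ} (hN : ∀ p ≤ n, 0 < Np p)
    (hG : ∀ p < n, ∀ x, 0 < G p x) : IsProbabilityMeasure (kLaw G Np n ω) := by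
  have hu := isProbabilityMeasure_unif (hN n le_rfl)
  have h : IsProbabilityMeasure ((kLaw G Np n ω).map fun k => (k.1 n, k.2 n)) := by
    rw [map_kLaw_terminal hN hG]
    infer_instance
  exact (Measure.isProbabilityMeasure_map_iff (by fun_prop)).1 h

theorem integral_kLaw_tens {n : ℕ} (hN : ∀ p ≤ n, 0 < Np p) (hG : ∀ p < n, ∀ x, 0 < G p x)
    (φ : Y → ℝ) :
    ∫ k, tens φ (ω.1 n (k.1 n), ω.1 n (k.2 n)) ∂kLaw G Np n ω = etaN Np n φ ω ^ 2 := by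
  have hu := isProbabilityMeasure_unif (hN n le_rfl)
  have h := integral_map (μ := kLaw G Np n ω) (φ := fun k => (k.1 n, k.2 n))
    (f := fun q : ℕ × ℕ => φ (ω.1 n q.1) * φ (ω.1 n q.2)) (by fun_prop)
    Measurable.of_discrete.aestronglyMeasurable
  rw [map_kLaw_terminal hN hG, integral_prod_mul (fun i => φ (ω.1 n i)) fun i => φ (ω.1 n i),
    integral_unif] at h
  simp only [tens, etaN, sq]
  exact h.symm

/-- The events `inI Np n (extB n b)`, `b` a binary string, partition the pairs of lineages. -/
theorem sum_indicator_inI {n : ℕ} {k : (ℕ → ℕ) × (ℕ → ℕ)}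
    (hk : ∀ p ≤ n, k.1 p < Np p ∧ k.2 p < Np p) :
    ∑ b : Fin (n + 1) → Bool, (if inI Np n (extB n b) k then (1 : ℝ) else 0) = 1 := by
  have hiff : ∀ b : Fin (n + 1) → Bool,
      inI Np n (extB n b) k ↔ b = fun p : Fin (n + 1) => decide (k.1 p = k.2 p) := by
    intro b
    constructor
    · intro h
      funext p
      have hp := (h p (by omega)).2.2
      simp only [extB, p.2, dite_true] at hp
      rw [Bool.eq_iff_iff, decide_eq_true_iff]
      exact hp.symm
    · rintro rfl p hp
      refine ⟨(hk p hp).1, (hk p hp).2, ?_⟩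
      simp [extB, Nat.lt_succ_of_le hp]
  simp [hiff]

theorem measurableSet_inI (Np : ℕ → ℕ) (n : ℕ) (b : ℕ → Bool) :
    MeasurableSet {k | inI Np n b k} :=
  (Measurable.forall fun p => Measurable.forall fun _ => Measurable.and
    (measurableSet_setOfPred.1 (measurableSet_lt (by fun_prop) measurable_const))
    (Measurable.and
      (measurableSet_setOfPred.1 (measurableSet_lt (by fun_prop) measurable_const))
      (Measurable.iff (measurableSet_setOfPred.1 (measurableSet_eq_fun (by fun_prop) (by fun_prop)))
        measurable_const))).setOf

theorem sum_integral_inI_mul {n : ℕ} (hN : ∀ p ≤ n, 0 < Np p) (hG : ∀ p < n, ∀ x, 0 < G p x)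
    (hA : ∀ q < n, ∀ i < Np (q + 1), ω.2 q i < Np q) {φ : Y × Y → ℝ} {C : ℝ}
    (hC : ∀ q, |φ q| ≤ C) :
    ∑ b : Fin (n + 1) → Bool, ∫ k, (if inI Np n (extB n b) k then (1 : ℝ) else 0) *
        φ (ω.1 n (k.1 n), ω.1 n (k.2 n)) ∂kLaw G Np n ω =
      ∫ k, φ (ω.1 n (k.1 n), ω.1 n (k.2 n)) ∂kLaw G Np n ω := by
  have hprob := isProbabilityMeasure_kLaw (ω := ω) hN hG
  have hφ : Measurable fun k : (ℕ → ℕ) × (ℕ → ℕ) => φ (ω.1 n (k.1 n), ω.1 n (k.2 n)) :=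
    (Measurable.of_discrete (f := fun q : ℕ × ℕ => φ (ω.1 n q.1, ω.1 n q.2))).comp
      (by fun_prop : Measurable fun k : (ℕ → ℕ) × (ℕ → ℕ) => (k.1 n, k.2 n))
  rw [← integral_finsetSum]
  · refine integral_congr_ae ?_
    filter_upwards [ae_kLaw_lt hA] with k hk
    rw [← Finset.sum_mul, sum_indicator_inI hk, one_mul]
  · intro b _
    refine Integrable.of_bound (C := C) ((Measurable.ite (measurableSet_inI Np n _)
      measurable_const measurable_const).mul hφ).aestronglyMeasurable (ae_of_all _ fun k => ?_)
    have h0 := hC (ω.1 n (k.1 n), ω.1 n (k.2 n))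
    split_ifs
    · simpa using h0
    · simpa using (abs_nonneg _).trans h0

end Tracing

theorem prod_weight_mul_prod_norm {Np : ℕ → ℕ} {n : ℕ} (hN : ∀ p ≤ n, 2 ≤ Np p) (b : ℕ → Bool) :
    (∏ p ∈ Finset.range (n + 1), if b p then ((Np p : ℝ))⁻¹ else 1 - ((Np p : ℝ))⁻¹) *
      (∏ p ∈ Finset.range (n + 1),
        if b p then (Np p : ℝ) else (Np p : ℝ) / ((Np p : ℝ) - 1)) = 1 := by
  rw [← Finset.prod_mul_distrib]
  refine Finset.prod_eq_one fun p hp => ?_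
  have h2 : (2 : ℝ) ≤ Np p := by
    exact_mod_cast hN p (Nat.lt_succ_iff.1 (Finset.mem_range.1 hp))
  have h0 : (Np p : ℝ) ≠ 0 := by linarith
  have h1 : (Np p : ℝ) - 1 ≠ 0 := by linarith
  split_ifs <;> field_simp

theorem etaN_one {Y : Type*} {Np : ℕ → ℕ} {n : ℕ} (hN : 0 < Np n)
    (ω : (ℕ → ℕ → Y) × (ℕ → ℕ → ℕ)) :
    etaN Np n 1 ω = 1 := by
  have : (Np n : ℝ) ≠ 0 := by exact_mod_cast hN.ne'
  simp [etaN, this]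

theorem statement11
    {X : Type*} [MeasurableSpace X] [Nonempty X] (hX : ∃ x y : X, x ≠ y) (n : ℕ)
    (M0 : Measure X) [IsProbabilityMeasure M0]
    (M : ℕ → Kernel X X) [∀ p, IsMarkovKernel (M p)]
    (G : ℕ → X → ℝ) (hGm : ∀ p ≤ n, Measurable (G p))
    (hGpos : ∀ p ≤ n, ∀ x, 0 < G p x) (hGbd : ∀ p ≤ n, ∃ C, ∀ x, G p x ≤ C)
    (c : ℕ → ℝ) (hc : ∀ p ≤ n, 0 < c p) :
    ∀ N : ℕ, 1 ≤ N → (∀ p ≤ n, 2 ≤ npart c N p) →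
      ∀ᵐ ω ∂(pfLaw M0 M G (npart c N) n),
        ∀ φ : X → ℝ, Measurable φ → (∃ C, ∀ x, |φ x| ≤ C) →
          gammaN G (npart c N) n φ ω ^ 2
            = ∑ b : Fin (n + 1) → Bool,
                (∏ p ∈ Finset.range (n + 1),
                    if extB n b p then ((npart c N p : ℝ))⁻¹
                    else 1 - ((npart c N p : ℝ))⁻¹) *
                  muBN G (npart c N) n (extB n b) (tens φ) ω := by
  intro N _ hN
  have hNpos : ∀ p ≤ n, 0 < npart c N p := fun p hp => by have := hN p hp; omega
  have hGpos' : ∀ p < n, ∀ x, 0 < G p x := fun p hp => hGpos p hp.le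
  filter_upwards [ae_pfLaw_ancestor_lt (M0 := M0) (M := M) n (fun p hp => hNpos p hp.le) hGpos']
    with ω hω φ _ hφ
  obtain ⟨C, hC⟩ := hφ
  have hbound : ∀ q, |tens φ q| ≤ C * C := fun q => by
    rw [tens, abs_mul]
    exact mul_le_mul (hC _) (hC _) (abs_nonneg _) ((abs_nonneg _).trans (hC q.1))
  simp only [muBN, ← mul_assoc]
  simp_rw [prod_weight_mul_prod_norm hN, one_mul]
  rw [← Finset.mul_sum, sum_integral_inI_mul hNpos hGpos' hω hbound,
    integral_kLaw_tens hNpos hGpos']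
  simp only [gammaN, etaN_one (hNpos n le_rfl)]
  ring
end PFVar
end
end
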